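/- Suppose Γ is odd (S(x, x) is odd for some x ∈ Γ). Then the number of ī-invariant quadratic forms q ∈ 𝒬_e^{(i)} satisfying ∑_{α ∈ A_i} i^{Q_q(α)} = −(√2)^g·e^{−iπg/4} in ℂ (equivalently: the Brown invariant of Q_q is ≡ 4 − g mod 8; these q correspond exactly to the i-invariant theta divisors Θ with multiplicity m₀(Θ) ≡ 2 mod 4 at the origin, i.e. to vanishing thetanulls of the principally polarized abelian variety A_Γ) equals 2^{g−2} − 2^{(g−2)/2}·cos(πg/4), as an equality of real numbers (with 2^{(g−2)/2} := (√2)^{g−2}). -/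

import Mathlib

/-- The embedding `F₂ ≅ 2ℤ/4ℤ ⊂ ℤ/4ℤ`. -/
def emb2 (t : ZMod 2) : ZMod 4 := 2 * t.val

/-- `i^c ∈ ℂ` for `c ∈ ℤ/4ℤ` (equal to `i^n` for any representative `n` of `c`). -/
noncomputable def iPow (c : ZMod 4) : ℂ := Complex.I ^ c.val

/-- The set of quadratic forms (with values in `ℤ/4ℤ`) associated to a symmetric
`F₂`-bilinear form `β`. -/
def QuadSet {V : Type*} [Add V] (β : V → V → ZMod 2) : Set (V → ZMod 4) :=
  {q | ∀ x y, q (x + y) = q x + q y + emb2 (β x y)}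

/-- `ε := id + ī`, an `F₂`-linear endomorphism of `A₂`. -/
def eps {A : Type*} [AddCommGroup A] [Module (ZMod 2) A]
    (Ibar : A →ₗ[ZMod 2] A) : A →ₗ[ZMod 2] A :=
  LinearMap.id + Ibar

/-- `A_i := ε(A₂)`. -/
def Asub {A : Type*} [AddCommGroup A] [Module (ZMod 2) A]
    (Ibar : A →ₗ[ZMod 2] A) : Submodule (ZMod 2) A :=
  LinearMap.range (eps Ibar)

/-- `εα`, as an element of `A_i`. -/
def epsEl {A : Type*} [AddCommGroup A] [Module (ZMod 2) A]
    (Ibar : A →ₗ[ZMod 2] A) (α : A) : ↥(Asub Ibar) :=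
  ⟨eps Ibar α, LinearMap.mem_range_self _ α⟩

lemma iPow_add (a b : ZMod 4) : iPow (a + b) = iPow a * iPow b := by
  have h : ∀ m : ℕ, iPow (m : ZMod 4) = Complex.I ^ m := by
    intro m
    unfold iPow
    rw [ZMod.val_natCast]
    conv_rhs => rw [← Nat.mod_add_div m 4, pow_add, pow_mul, Complex.I_pow_four, one_pow, mul_one]
  have ha := h a.val
  have hb := h b.val
  have hab := h (a.val + b.val)
  rw [pow_add, ← ha, ← hb] at hab
  simpa using hab

lemma iPow_zero : iPow 0 = 1 := by simp [iPow]
lemma iPow_one : iPow 1 = Complex.I := by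
  have : (1 : ZMod 4).val = 1 := rfl
  simp [iPow, this]
lemma iPow_two : iPow 2 = -1 := by
  have : (2 : ZMod 4).val = 2 := rfl
  simp [iPow, this]
lemma iPow_three : iPow 3 = -Complex.I := by
  have : (3 : ZMod 4).val = 3 := rfl
  simp [iPow, this, pow_succ]

lemma zmod4_cases (a : ZMod 4) : a = 0 ∨ a = 1 ∨ a = 2 ∨ a = 3 := by
  revert a; decide

lemma iPow_neg (a : ZMod 4) : iPow (-a) = (starRingEnd ℂ) (iPow a) := by
  have h1 : (-1 : ZMod 4) = 3 := rfl
  have h2 : (-2 : ZMod 4) = 2 := rfl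
  have h3 : (-3 : ZMod 4) = 1 := rfl
  rcases zmod4_cases a with rfl | rfl | rfl | rfl <;>
    simp [h1, h2, h3, iPow_zero, iPow_one, iPow_two, iPow_three]

lemma iPow_ne_zero (a : ZMod 4) : iPow a ≠ 0 := by
  unfold iPow
  exact pow_ne_zero _ Complex.I_ne_zero

lemma iPow_inj {a b : ZMod 4} (h : iPow a = iPow b) : a = b := by
  rcases zmod4_cases a with rfl | rfl | rfl | rfl <;>
  rcases zmod4_cases b with rfl | rfl | rfl | rfl <;> first | rfl | (
    exfalso
    simp [iPow_zero, iPow_one, iPow_two, iPow_three, Complex.ext_iff] at h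
    try norm_num at h)

lemma iPow_ind (c : ZMod 4) : (1 + iPow c + iPow (2 * c) + (starRingEnd ℂ) (iPow c)) / 4
    = if c = 0 then 1 else 0 := by
  have h2 : (2 * 2 : ZMod 4) = 0 := rfl
  have h3 : (2 * 3 : ZMod 4) = 2 := rfl
  have e1 : (1 : ZMod 4) ≠ 0 := by decide
  have e2 : (2 : ZMod 4) ≠ 0 := by decide
  have e3 : (3 : ZMod 4) ≠ 0 := by decide
  rcases zmod4_cases c with rfl | rfl | rfl | rfl <;>
    simp [h2, h3, e1, e2, e3, iPow_zero, iPow_one, iPow_two, iPow_three]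
  norm_num

lemma emb2_add (s t : ZMod 2) : emb2 (s + t) = emb2 s + emb2 t := by
  revert s t; decide
lemma emb2_self (s : ZMod 2) : emb2 s + emb2 s = 0 := by
  revert s; decide
lemma emb2_inj {s t : ZMod 2} (h : emb2 s = emb2 t) : s = t := by
  revert s t; decide
lemma emb2_int (n : ℤ) : emb2 (n : ZMod 2) = 2 * (n : ZMod 4) := by
  have h : ∀ m : ZMod 4, emb2 (ZMod.castHom (show 2 ∣ 4 by norm_num) (ZMod 2) m) = 2 * m := by
    decide
  have := h (n : ZMod 4)
  rwa [map_intCast] at this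

/-- character sums -/
lemma char_sum {V : Type*} [AddCommGroup V] [Fintype V] (χ : V → ZMod 2)
    (hχ : ∀ x y, χ (x + y) = χ x + χ y) (h : ∃ x, χ x ≠ 0) :
    ∑ x, iPow (emb2 (χ x)) = 0 := by
  obtain ⟨a, ha⟩ := h
  have ha1 : χ a = 1 := by
    revert ha; generalize χ a = t; revert t; decide
  have h1 : ∑ x, iPow (emb2 (χ x)) = ∑ x, iPow (emb2 (χ (a + x))) :=
    (Equiv.sum_comp (Equiv.addLeft a) (fun x => iPow (emb2 (χ x)))).symm
  have h2 : emb2 1 = 2 := rfl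
  simp_rw [hχ, emb2_add, iPow_add, ha1, h2, iPow_two] at h1
  rw [← Finset.mul_sum] at h1
  have : (2 : ℂ) * ∑ x, iPow (emb2 (χ x)) = 0 := by linear_combination h1
  simpa using this

lemma gauss_int (n : ℕ) : ∀ a b : ℤ, a ^ 2 + b ^ 2 = 2 ^ n →
    ∃ k : ZMod 4, (a : ℂ) + b * Complex.I = iPow k * (1 - Complex.I) ^ n := by
  induction n with
  | zero =>
    intro a b h
    have ha : a ≤ 1 := by nlinarith
    have ha' : -1 ≤ a := by nlinarith
    have hb : b ≤ 1 := by nlinarith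
    have hb' : -1 ≤ b := by nlinarith
    interval_cases a <;> interval_cases b <;> simp at h
    · exact ⟨2, by simp [iPow_two]⟩
    · exact ⟨3, by simp [iPow_three]⟩
    · exact ⟨1, by simp [iPow_one]⟩
    · exact ⟨0, by simp [iPow_zero]⟩
  | succ n ih =>
    intro a b h
    have hpar : (a - b) % 2 = 0 := by
      have h1 : (a ^ 2 + b ^ 2) % 2 = 0 := by rw [h, pow_succ]; simp
      rcases Int.emod_two_eq_zero_or_one a with h2 | h2 <;>
      rcases Int.emod_two_eq_zero_or_one b with h3 | h3 <;>
      simp [Int.add_emod, pow_two, Int.mul_emod, h2, h3] at h1 <;> omega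
    obtain ⟨c, hc⟩ := Int.dvd_of_emod_eq_zero hpar
    have ha : a = b + 2 * c := by linarith
    subst ha
    obtain ⟨k, hk⟩ := ih c (b + c) (by
      rw [pow_succ 2 n] at h; nlinarith)
    refine ⟨k, ?_⟩
    rw [pow_succ, ← mul_assoc, ← hk]
    push_cast
    linear_combination ((b : ℂ) + c) * Complex.I_sq

lemma exists_quad {V : Type*} [AddCommGroup V] [Module (ZMod 2) V] [Finite V]
    (b : V →ₗ[ZMod 2] V →ₗ[ZMod 2] ZMod 2) (hs : ∀ x y, b x y = b y x) :
    ∃ R, R ∈ QuadSet (fun x y => b x y) := by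
  classical
  let v := Module.finBasis (ZMod 2) V
  let n := Module.finrank (ZMod 2) V
  let β : Fin n → Fin n → ZMod 4 := fun j k => ((b (v j) (v k)).val : ZMod 4)
  have hβ : ∀ j k, β j k = β k j := fun j k => by simp only [β]; rw [hs]
  let c : V → Fin n → ZMod 4 := fun x j => ((v.repr x j).val : ZMod 4)
  let B : (Fin n → ZMod 4) → (Fin n → ZMod 4) → ZMod 4 :=
    fun x y => ∑ j, ∑ k, x j * y k * β j k
  have Badd1 : ∀ x y z, B (x + y) z = B x z + B y z := by
    intro x y z; simp only [B, Pi.add_apply, add_mul, Finset.sum_add_distrib]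
  have Badd2 : ∀ x y z, B x (y + z) = B x y + B x z := by
    intro x y z; simp only [B, Pi.add_apply, mul_add, add_mul, Finset.sum_add_distrib]
  have Bsymm : ∀ x y, B x y = B y x := by
    intro x y
    simp only [B]
    rw [Finset.sum_comm]
    refine Finset.sum_congr rfl fun j _ => Finset.sum_congr rfl fun k _ => ?_
    rw [hβ k j]; ring
  have hz : ∀ s t : ZMod 2, ∃ w : ZMod 4, ((s + t).val : ZMod 4) = s.val + t.val + (w + w) := by
    decide
  have hcadd : ∀ x y, ∃ z, c (x + y) = c x + c y + (z + z) := by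
    intro x y
    choose z hz' using fun j => hz (v.repr x j) (v.repr y j)
    refine ⟨z, ?_⟩
    funext j
    simpa [c] using hz' j
  have hemb : ∀ x y, emb2 (b x y) = B (c x) (c y) + B (c x) (c y) := by
    intro x y
    let E : ZMod 2 →+ ZMod 4 := ⟨⟨emb2, rfl⟩, emb2_add⟩
    have h3 : ∀ s t u : ZMod 2, emb2 (s * (t * u)) =
      (s.val * t.val * u.val : ZMod 4) + (s.val * t.val * u.val : ZMod 4) := by decide
    have h1 : b x y = ∑ j, ∑ k, v.repr x j * (v.repr y k * b (v j) (v k)) := by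
      conv_lhs => rw [← v.sum_repr x, ← v.sum_repr y]
      simp only [map_sum, LinearMap.sum_apply, map_smul, LinearMap.smul_apply, smul_eq_mul]
      simp only [Finset.mul_sum]
      rw [Finset.sum_comm]
      refine Finset.sum_congr rfl fun j _ => ?_
      refine Finset.sum_congr rfl fun k _ => ?_
      ring
    rw [h1]
    change E (∑ j, ∑ k, v.repr x j * (v.repr y k * b (v j) (v k))) = _
    rw [map_sum E]
    simp only [B]
    rw [← Finset.sum_add_distrib]
    refine Finset.sum_congr rfl fun j _ => ?_
    rw [map_sum E, ← Finset.sum_add_distrib]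
    refine Finset.sum_congr rfl fun k _ => ?_
    exact h3 _ _ _
  refine ⟨fun x => B (c x) (c x), ?_⟩
  intro x y
  obtain ⟨z, hz⟩ := hcadd x y
  have h4 : (4 : ZMod 4) = 0 := rfl
  simp only [hz, hemb, Badd1, Badd2]
  rw [Bsymm z (c x), Bsymm z (c y), Bsymm (c y) (c x)]
  linear_combination (B (c x) z + B (c y) z + B z z) * h4

lemma target_eq (g : ℕ) : -((Real.sqrt 2 : ℂ)) ^ g *
            Complex.exp (-((Real.pi * g / 4 : ℝ) : ℂ) * Complex.I)
    = iPow 2 * (1 - Complex.I) ^ g := by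
  have h : (Real.sqrt 2 : ℂ) * Complex.exp (-((Real.pi / 4 : ℝ) : ℂ) * Complex.I)
      = 1 - Complex.I := by
    have h2 : Real.sqrt 2 * Real.sqrt 2 = 2 := Real.mul_self_sqrt (by norm_num)
    rw [← Complex.ofReal_neg, Complex.exp_mul_I, ← Complex.ofReal_cos, ← Complex.ofReal_sin,
      Real.cos_neg, Real.sin_neg, Real.cos_pi_div_four, Real.sin_pi_div_four]
    apply Complex.ext <;> simp <;> linarith
  rw [← h, mul_pow, ← Complex.exp_nat_mul, iPow_two]
  have : (g : ℂ) * (-((Real.pi / 4 : ℝ) : ℂ) * Complex.I)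
      = (-((Real.pi * g / 4 : ℝ) : ℂ) * Complex.I) := by push_cast; ring
  rw [this]; ring

lemma target_re (g : ℕ) : (-((Real.sqrt 2 : ℂ)) ^ g *
            Complex.exp (-((Real.pi * g / 4 : ℝ) : ℂ) * Complex.I)).re
    = - (Real.sqrt 2 ^ g * Real.cos (Real.pi * g / 4)) := by
  rw [← Complex.ofReal_neg, Complex.exp_mul_I, ← Complex.ofReal_cos, ← Complex.ofReal_sin,
      Real.cos_neg, ← Complex.ofReal_pow, ← Complex.ofReal_neg, Complex.re_ofReal_mul]
  rw [Complex.add_re, Complex.ofReal_re, Complex.re_ofReal_mul, Complex.I_re]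
  ring

lemma count_main {V : Type*} [AddCommGroup V] [Module (ZMod 2) V] [Finite V] (g : ℕ)
    (hcard : Nat.card V = 2 ^ g)
    (b : V →ₗ[ZMod 2] V →ₗ[ZMod 2] ZMod 2) (hs : ∀ x y, b x y = b y x)
    (hnd : ∀ x, (∀ y, b x y = 0) → x = 0) (hodd : ∃ x, b x x ≠ 0) :
    (Nat.card {R : V → ZMod 4 // R ∈ QuadSet (fun x y => b x y) ∧
      ∑ᶠ α : V, iPow (R α) = -((Real.sqrt 2 : ℂ)) ^ g *
            Complex.exp (-((Real.pi * g / 4 : ℝ) : ℂ) * Complex.I)} : ℝ) =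
      (2 : ℝ) ^ ((g : ℤ) - 2) -
        (Real.sqrt 2) ^ ((g : ℤ) - 2) * Real.cos (Real.pi * g / 4) := by
  classical
  have := Fintype.ofFinite V
  obtain ⟨R, hR⟩ := exists_quad b hs
  have hR' : ∀ x y, R (x + y) = R x + R y + emb2 (b x y) := hR
  have hcard' : (Fintype.card V : ℂ) = 2 ^ g := by
    rw [← Nat.card_eq_fintype_card, hcard]; push_cast; rfl
  have he0 : emb2 0 = 0 := rfl
  have hR0 : ∀ R' ∈ QuadSet (fun x y => b x y), R' 0 = 0 := by
    intro R' hR'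
    have := hR' 0 0
    simpa [he0] using this
  have hxx : ∀ x : V, x + x = 0 := fun x => by
    rw [← two_smul (ZMod 2) x, show (2 : ZMod 2) = 0 from rfl, zero_smul]
  have hRpar : ∀ x, 2 * R x = emb2 (b x x) := by
    intro x
    have := hR' x x
    rw [hxx, hR0 R hR] at this
    linear_combination -this - emb2_self (b x x)
  set T := -((Real.sqrt 2 : ℂ)) ^ g *
            Complex.exp (-((Real.pi * g / 4 : ℝ) : ℂ) * Complex.I) with hT
  set γ := ∑ x, iPow (R x) with hγ
  -- norm
  have hnorm : γ * (starRingEnd ℂ) γ = 2 ^ g := by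
    have h1 : γ * (starRingEnd ℂ) γ = ∑ z, ∑ y, iPow (R z) * iPow (emb2 (b z y)) := by
      rw [hγ, map_sum, Finset.sum_mul_sum, Finset.sum_comm]
      rw [Finset.sum_comm (γ := V) (s := Finset.univ) (t := Finset.univ) (f := fun z y => iPow (R z) * iPow (emb2 (b z y)))]
      refine Finset.sum_congr rfl fun y _ => ?_
      rw [← Equiv.sum_comp (Equiv.addRight y)]
      refine Finset.sum_congr rfl fun z _ => ?_
      simp only [Equiv.coe_addRight]
      rw [← iPow_neg, ← iPow_add, ← iPow_add, hR']
      congr 1; ring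
    rw [h1, Finset.sum_eq_single 0]
    · simp [he0, hR0 R hR, iPow_zero, hcard']
    · intro z _ hz
      rw [← Finset.mul_sum, char_sum, mul_zero]
      · intro x y; simp
      · by_contra! h
        exact hz (hnd z h)
    · simp
  -- Gaussian integer
  obtain ⟨u, w, huw⟩ : ∃ u w : ℤ, γ = u + w * Complex.I := by
    rw [hγ]
    refine Finset.sum_induction _ (fun z : ℂ => ∃ u w : ℤ, z = u + w * Complex.I) ?_ ?_ ?_
    · rintro _ _ ⟨a, b, rfl⟩ ⟨c, d, rfl⟩
      exact ⟨a + c, b + d, by push_cast; ring⟩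
    · exact ⟨0, 0, by simp⟩
    · intro x _
      rcases zmod4_cases (R x) with h | h | h | h <;> rw [h]
      · exact ⟨1, 0, by simp [iPow_zero]⟩
      · exact ⟨0, 1, by simp [iPow_one]⟩
      · exact ⟨-1, 0, by simp [iPow_two]⟩
      · exact ⟨0, -1, by simp [iPow_three]⟩
  have huw2 : u ^ 2 + w ^ 2 = 2 ^ g := by
    rw [huw] at hnorm
    simp only [map_add, map_mul, Complex.conj_I, map_intCast] at hnorm
    have : ((u ^ 2 + w ^ 2 : ℤ) : ℂ) = ((2 ^ g : ℤ) : ℂ) := by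
      push_cast
      linear_combination hnorm + (w : ℂ) ^ 2 * Complex.I_sq
    exact_mod_cast this
  obtain ⟨k', hk'⟩ := gauss_int g u w huw2
  obtain ⟨k, hk⟩ : ∃ k, γ = iPow k * T := by
    refine ⟨k' + 2, ?_⟩
    rw [hT, target_eq, huw, hk', iPow_add, iPow_two]; ring
  have hT0 : T ≠ 0 := by
    intro h
    rw [hk, h] at hnorm
    simp only [mul_zero, zero_mul] at hnorm
    exact absurd hnorm.symm (pow_ne_zero _ two_ne_zero)
  -- sums of translates
  have hsum : ∀ c : V, ∑ x, iPow (R x + emb2 (b c x)) = iPow (-R c) * γ := by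
    intro c
    rw [hγ, ← Equiv.sum_comp (Equiv.addLeft c) (fun x => iPow (R x)), Finset.mul_sum]
    refine Finset.sum_congr rfl fun x _ => ?_
    rw [← iPow_add]
    simp only [Equiv.coe_addLeft, hR']
    congr 1; ring
  have hbinj : Function.Injective b := by
    rw [injective_iff_map_eq_zero]
    intro x hx
    exact hnd x fun y => by rw [hx]; rfl
  have hbsurj : Function.Surjective b :=
    (LinearMap.injective_iff_surjective_of_finrank_eq_finrank
      (Subspace.dual_finrank_eq (K := ZMod 2) (V := V)).symm).1 hbinj
  have hadd4 : ∀ s : ZMod 4, 2 * s = 0 → ∃ t : ZMod 2, s = emb2 t := by decide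
  let F : {c : V // R c = k} → {R : V → ZMod 4 // R ∈ QuadSet (fun x y => b x y) ∧
      ∑ᶠ α : V, iPow (R α) = T} := fun c => ⟨fun x => R x + emb2 (b c.1 x), by
    constructor
    · intro x y
      simp only [hR', map_add, emb2_add]; ring
    · rw [finsum_eq_sum_of_fintype, hsum, hk, ← mul_assoc, ← iPow_add, c.2]
      simp [iPow_zero]⟩
  have hF : Function.Bijective F := by
    constructor
    · rintro ⟨c, hc⟩ ⟨d, hd⟩ h
      have h1 := congrArg Subtype.val h
      apply Subtype.ext
      apply hbinj
      ext x
      have h2 := congrFun h1 x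
      exact emb2_inj (add_left_cancel h2)
    · rintro ⟨R', hR1, hR2⟩
      have hR1' : ∀ x y, R' (x + y) = R' x + R' y + emb2 (b x y) := hR1
      have h1 : ∀ x, ∃ t : ZMod 2, R' x - R x = emb2 t := by
        intro x
        apply hadd4
        have := hR1' x x
        rw [hxx, hR0 R' hR1] at this
        linear_combination -this - hRpar x - emb2_self (b x x)
      choose χ hχ using h1
      have hχadd : ∀ x y, χ (x + y) = χ x + χ y := by
        intro x y
        apply emb2_inj
        rw [emb2_add, ← hχ, ← hχ, ← hχ, hR', hR1']; ring
      let χl : V →ₗ[ZMod 2] ZMod 2 := (AddMonoidHom.mk' χ hχadd).toZModLinearMap 2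
      obtain ⟨c, hc⟩ := hbsurj χl
      have hRc : ∀ x, R' x = R x + emb2 (b c x) := by
        intro x
        rw [hc]
        change _ = _ + emb2 (χ x)
        rw [← hχ]; ring
      have hck : R c = k := by
        rw [finsum_eq_sum_of_fintype] at hR2
        simp_rw [hRc] at hR2
        rw [hsum, hk, ← mul_assoc, ← iPow_add] at hR2
        have h3 : iPow (-R c + k) = iPow 0 := by
          rw [iPow_zero]
          exact mul_right_cancel₀ hT0 (by rw [hR2, one_mul])
        have := iPow_inj h3
        linear_combination -this
      refine ⟨⟨c, hck⟩, ?_⟩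
      apply Subtype.ext
      funext x
      exact (hRc x).symm
  rw [← Nat.card_congr (Equiv.ofBijective F hF)]
  -- count
  have hcnt : ((Nat.card {c : V // R c = k} : ℝ) : ℂ) = ((2 ^ g + 2 * T.re : ℝ) : ℂ) / 4 := by
    have h1 : ((Nat.card {c : V // R c = k} : ℝ) : ℂ) = ∑ x, if R x - k = 0 then (1 : ℂ) else 0 := by
      rw [Nat.card_eq_fintype_card, Fintype.card_subtype]
      simp [sub_eq_zero]
    rw [h1]
    simp_rw [← iPow_ind]
    rw [← Finset.sum_div]
    congr 1
    rw [Finset.sum_add_distrib, Finset.sum_add_distrib, Finset.sum_add_distrib]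
    have h2 : ∑ x, iPow (R x - k) = T := by
      simp_rw [sub_eq_add_neg, iPow_add]
      rw [← Finset.sum_mul, ← hγ, hk, mul_right_comm, ← iPow_add]
      simp [iPow_zero]
    have h3 : ∑ x, iPow (2 * (R x - k)) = 0 := by
      have : ∀ x, iPow (2 * (R x - k)) = iPow (emb2 (b x x)) * iPow (-(2 * k)) := by
        intro x
        rw [← iPow_add, ← hRpar]; congr 1; ring
      simp_rw [this]
      rw [← Finset.sum_mul, char_sum, zero_mul]
      · intro x y
        simp only [map_add, LinearMap.add_apply]
        rw [hs y x]
        have : ∀ p q r : ZMod 2, p + q + (q + r) = p + r := by decide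
        exact this _ _ _
      · exact hodd
    rw [← map_sum, h2, h3]
    simp only [Finset.sum_const, Finset.card_univ, nsmul_eq_mul, mul_one, hcard', add_zero]
    rw [add_assoc, Complex.add_conj]
    push_cast; ring
  have hcnt' : (Nat.card {c : V // R c = k} : ℝ) = (2 ^ g + 2 * T.re) / 4 := by exact_mod_cast hcnt
  have hq : Real.sqrt 2 ^ 2 = 2 := Real.sq_sqrt (by norm_num)
  have hq0 : Real.sqrt 2 ≠ 0 := by positivity
  rw [hcnt', hT, target_re, zpow_sub₀ (by norm_num), zpow_sub₀ hq0]
  simp only [zpow_natCast, zpow_ofNat, hq]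
  ring

/-- Suppose `Γ` is odd.  Then the number of `ī`-invariant quadratic forms
`q ∈ 𝒬_e^{(i)}` whose Gauss sum `∑_{α ∈ A_i} i^{Q_q(α)}` equals `−(√2)^g·e^{−iπg/4}`
(equivalently: the Brown invariant of `Q_q` is `≡ 4 − g mod 8`; these `q` correspond exactly
to the vanishing thetanulls of `A_Γ`) equals `2^{g−2} − 2^{(g−2)/2}·cos(πg/4)`, as an equality
of real numbers (with `2^{(g−2)/2} := (√2)^{g−2}`). -/
theorem statement3 (g : ℕ) (hg : 1 ≤ g)
    (Γ : Type) [AddCommGroup Γ] [Module ℤ Γ]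
    [Module.Free ℤ Γ] [Module.Finite ℤ Γ]
    (hrank : Module.finrank ℤ Γ = 2 * g)
    (S : Γ →ₗ[ℤ] Γ →ₗ[ℤ] ℤ)
    (hSsymm : ∀ x y : Γ, S x y = S y x)
    (hSpos : ∀ x : Γ, x ≠ 0 → 0 < S x x)
    (I : Γ ≃ₗ[ℤ] Γ)
    (hI2 : ∀ x : Γ, I (I x) = -x)
    (hSI : ∀ x y : Γ, S (I x) (I y) = S x y)
    (hunimod : Function.Bijective fun x : Γ => S x)
    (hodd : ∃ x : Γ, ¬ 2 ∣ S x x)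
    (A₂ : Type) [AddCommGroup A₂] [Module (ZMod 2) A₂] [Finite A₂]
    (pr : Γ →+ A₂) (hpr : Function.Surjective pr)
    (hker : ∀ x : Γ, pr x = 0 ↔ ∃ y : Γ, x = 2 • y)
    (Ibar : A₂ →ₗ[ZMod 2] A₂) (hIbar : ∀ x : Γ, Ibar (pr x) = pr (I x))
    (e : A₂ →ₗ[ZMod 2] A₂ →ₗ[ZMod 2] ZMod 2)
    (he : ∀ x y : Γ, e (pr x) (pr y) = ((S (I x) y : ℤ) : ZMod 2))
    (Q : A₂ → ZMod 4)
    (hQ : ∀ x : Γ, Q (pr x) = ((S x x : ℤ) : ZMod 4))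
    -- the map `q ↦ Q_q`, where `Q_q` is determined by `Q_q(εα) = q(α) − Q(α)`
    (Qmap : (A₂ → ZMod 4) → (↥(Asub Ibar) → ZMod 4))
    (hQmap : ∀ q ∈ QuadSet (fun x y => e x y) ∩ {q | ∀ x, q (Ibar x) = q x},
      ∀ α : A₂, Qmap q (epsEl Ibar α) = q α - Q α) :
    (Nat.card {q : A₂ → ZMod 4 //
        q ∈ QuadSet (fun x y => e x y) ∧ (∀ x, q (Ibar x) = q x) ∧
        ∑ᶠ α : ↥(Asub Ibar), iPow (Qmap q α) =
          -((Real.sqrt 2 : ℂ)) ^ g *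
            Complex.exp (-((Real.pi * g / 4 : ℝ) : ℂ) * Complex.I)} : ℝ) =
      (2 : ℝ) ^ ((g : ℤ) - 2) -
        (Real.sqrt 2) ^ ((g : ℤ) - 2) * Real.cos (Real.pi * g / 4) := by
  classical
  obtain rfl : (‹Module ℤ Γ› : Module ℤ Γ) = AddCommGroup.toIntModule Γ := Subsingleton.elim _ _
  have hxx : ∀ a : A₂, a + a = 0 := fun x => by
    rw [← two_smul (ZMod 2) x, show (2 : ZMod 2) = 0 from rfl, zero_smul]
  have hneg : ∀ a : A₂, -a = a := fun a => by rw [neg_eq_iff_add_eq_zero]; exact hxx a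
  have hII : ∀ a, Ibar (Ibar a) = a := by
    intro a
    obtain ⟨x, rfl⟩ := hpr a
    rw [hIbar, hIbar, hI2, map_neg, hneg]
  have hepsI : ∀ a, epsEl Ibar (Ibar a) = epsEl Ibar a := by
    intro a
    apply Subtype.ext
    simp only [epsEl, eps, LinearMap.add_apply, LinearMap.id_apply, hII]
    abel
  have hepsadd : ∀ a c, epsEl Ibar (a + c) = epsEl Ibar a + epsEl Ibar c := by
    intro a c
    apply Subtype.ext
    simp [epsEl]
  have hepssurj : ∀ u : Asub Ibar, ∃ a, epsEl Ibar a = u := by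
    rintro ⟨_, a, rfl⟩
    exact ⟨a, rfl⟩
  have htf : ∀ x y : Γ, x + x = y + y → x = y := by
    intro x y h
    have h1 : (2 : ℤ) • (x - y) = 0 := by
      rw [two_smul]; 
      have : x - y + (x - y) = (x + x) - (y + y) := by abel
      rw [this, h, sub_self]
    rcases smul_eq_zero.1 h1 with h | h
    · norm_num at h
    · exact sub_eq_zero.1 h
  have hpre : ∀ x, eps Ibar (pr x) = pr (x + I x) := by
    intro x; simp [eps, hIbar]
  -- kernel of eps is the image of eps
  have hkerrange : ∀ a, eps Ibar a = 0 → ∃ c, a = eps Ibar c := by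
    intro a h
    obtain ⟨x, rfl⟩ := hpr a
    rw [hpre, hker] at h
    obtain ⟨y, hy⟩ := h
    refine ⟨pr y, ?_⟩
    have hx : x = y - I y := by
      apply htf
      have h1 : I (x + I x) = I (2 • y) := by rw [hy]
      rw [map_add, hI2, two_smul, map_add] at h1
      rw [two_smul] at hy
      have h2 : x + x = (x + I x) - (I x + -x) := by abel
      rw [h2, h1, hy]; abel
    rw [hx, hpre, map_sub, map_add, sub_eq_add_neg, hneg]
  have hrangeker : ∀ c, eps Ibar (eps Ibar c) = 0 := by
    intro c
    have h := hII c
    simp only [eps, LinearMap.add_apply, LinearMap.id_apply, map_add, h]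
    rw [add_comm (Ibar c) c]; exact hxx _
  have hSsk : ∀ x y, S x (I y) = - S (I x) y := by
    intro x y
    rw [← hSI x (I y), hI2, map_neg]
  have h22 : ∀ s : ZMod 2, s + s = 0 := by decide
  have h2n : ∀ s : ZMod 2, -s = s := by decide
  have hee : ∀ a c, e (eps Ibar a) (eps Ibar c) = 0 := by
    intro a c
    obtain ⟨x, rfl⟩ := hpr a
    obtain ⟨y, rfl⟩ := hpr c
    rw [hpre, hpre, he]
    simp only [map_add, LinearMap.add_apply, hI2, map_neg, LinearMap.neg_apply, hSI, hSsk]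
    push_cast
    ring_nf
    rw [show (2 : ZMod 2) = 0 from rfl, mul_zero]
  have heeps : ∀ x y, e (pr x) (eps Ibar (pr y)) = ((S (x + I x) y : ℤ) : ZMod 2) := by
    intro x y
    rw [hpre, he]
    simp only [map_add, LinearMap.add_apply, hSI]
    push_cast; ring
  -- the section and the form b
  obtain ⟨σ, hσ⟩ := LinearMap.exists_rightInverse_of_surjective (eps Ibar).rangeRestrict
    (LinearMap.range_rangeRestrict _)
  let b : Asub Ibar →ₗ[ZMod 2] Asub Ibar →ₗ[ZMod 2] ZMod 2 :=
    e.compl₁₂ σ (Asub Ibar).subtype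
  have hb : ∀ a c, b (epsEl Ibar a) (epsEl Ibar c) = e a (eps Ibar c) := by
    intro a c
    change e (σ (epsEl Ibar a)) (eps Ibar c) = _
    have h1 : eps Ibar (σ (epsEl Ibar a)) = eps Ibar a := by
      have := congrArg Subtype.val (LinearMap.congr_fun hσ (epsEl Ibar a))
      exact this
    obtain ⟨d, hd⟩ := hkerrange (σ (epsEl Ibar a) - a) (by rw [map_sub, h1, sub_self])
    rw [sub_eq_iff_eq_add.1 hd, map_add, LinearMap.add_apply, hee, zero_add]
  have hbpr : ∀ x y, b (epsEl Ibar (pr x)) (epsEl Ibar (pr y)) = ((S (x + I x) y : ℤ) : ZMod 2) := by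
    intro x y; rw [hb, heeps]
  have hbs : ∀ u v, b u v = b v u := by
    intro u v
    obtain ⟨a, rfl⟩ := hepssurj u
    obtain ⟨c, rfl⟩ := hepssurj v
    obtain ⟨x, rfl⟩ := hpr a
    obtain ⟨y, rfl⟩ := hpr c
    rw [hbpr, hbpr]
    simp only [map_add, LinearMap.add_apply]
    rw [hSsymm y x, hSsymm (I y) x, hSsk]
    push_cast
    rw [h2n]
  have hbnd : ∀ u, (∀ v, b u v = 0) → u = 0 := by
    intro u hu
    obtain ⟨a, rfl⟩ := hepssurj u
    obtain ⟨x, rfl⟩ := hpr a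
    have h1 : ∀ y, (2 : ℤ) ∣ S (x + I x) y := by
      intro y
      have := hu (epsEl Ibar (pr y))
      rw [hbpr] at this
      exact (ZMod.intCast_zmod_eq_zero_iff_dvd _ 2).1 this
    choose f hf using h1
    have hfadd : ∀ y z, f (y + z) = f y + f z := by
      intro y z
      have h2 := hf (y + z)
      rw [map_add, hf y, hf z] at h2
      linarith
    let F : Γ →ₗ[ℤ] ℤ := 
      { toFun := f, map_add' := hfadd, map_smul' := by
          intro m y
          have h2 := hf (m • y)
          rw [map_smul, hf y, smul_eq_mul] at h2
          simp only [smul_eq_mul, RingHom.id_apply]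
          linarith }
    obtain ⟨z, hz⟩ := hunimod.2 F
    have hz' : S z = F := hz
    have h3 : x + I x = z + z := by
      apply hunimod.1
      change S (x + I x) = S (z + z)
      ext y
      rw [hf, map_add, hz', LinearMap.add_apply]
      change _ = f y + f y
      ring
    apply Subtype.ext
    change eps Ibar (pr x) = 0
    rw [hpre, hker]
    exact ⟨z, by rw [h3, two_smul]⟩
  have hSI0 : ∀ x, S (I x) x = 0 := by
    intro x
    have h1 := hSsk x x
    rw [hSsymm x (I x)] at h1
    linarith
  have hbodd : ∃ u, b u u ≠ 0 := by
    obtain ⟨x, hx⟩ := hodd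
    refine ⟨epsEl Ibar (pr x), ?_⟩
    rw [hbpr, map_add, LinearMap.add_apply, hSI0, add_zero]
    intro h
    exact hx ((ZMod.intCast_zmod_eq_zero_iff_dvd _ 2).1 h)
  -- cardinalities
  have hcardA : Nat.card A₂ = 2 ^ (2 * g) := by
    let B := Module.finBasis ℤ Γ
    let r : Γ →+ (Fin (Module.finrank ℤ Γ) → ZMod 2) :=
      { toFun := fun x j => ((B.repr x j : ℤ) : ZMod 2)
        map_zero' := by funext j; simp
        map_add' := by intro x y; funext j; simp }
    have hr : Function.Surjective r := by
      intro f
      refine ⟨∑ j, ((f j).val : ℤ) • B j, ?_⟩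
      funext j
      change ((B.repr _ j : ℤ) : ZMod 2) = _
      rw [B.repr_sum_self]
      simp
    have hkk : pr.ker = r.ker := by
      ext x
      rw [AddMonoidHom.mem_ker, AddMonoidHom.mem_ker, hker]
      constructor
      · rintro ⟨y, rfl⟩
        rw [two_smul, map_add]
        funext j
        exact h22 _
      · intro h
        have h1 : ∀ j, (2 : ℤ) ∣ B.repr x j := fun j =>
          (ZMod.intCast_zmod_eq_zero_iff_dvd _ 2).1 (congrFun h j)
        choose f hf using h1
        refine ⟨∑ j, f j • B j, ?_⟩
        rw [two_smul]
        apply B.ext_elem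
        intro j
        rw [map_add, Finsupp.add_apply, B.repr_sum_self, hf]
        ring
    have e1 := QuotientAddGroup.quotientKerEquivOfSurjective pr hpr
    have e2 := QuotientAddGroup.quotientKerEquivOfSurjective r hr
    rw [← Nat.card_congr e1.toEquiv, hkk, Nat.card_congr e2.toEquiv]
    simp [hrank]
  have hcard : Nat.card (Asub Ibar) = 2 ^ g := by
    have h1 : LinearMap.ker (eps Ibar) = Asub Ibar := by
      ext a
      constructor
      · intro h
        obtain ⟨c, hc⟩ := hkerrange a h
        exact ⟨c, hc.symm⟩
      · rintro ⟨c, rfl⟩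
        exact hrangeker c
    have h2 := Submodule.card_eq_card_quotient_mul_card (LinearMap.ker (eps Ibar))
    rw [Nat.card_congr (eps Ibar).quotKerEquivRange.toEquiv, h1, hcardA] at h2
    change 2 ^ (2 * g) = _ * Nat.card (Asub Ibar) at h2
    have h3 : Nat.card (Asub Ibar) ^ 2 = (2 ^ g) ^ 2 := by
      rw [pow_two, ← pow_mul, mul_comm g 2, h2]
    exact Nat.pow_left_injective (by norm_num : 2 ≠ 0) h3
  -- Q
  have hQadd : ∀ a c, Q (a + c) = Q a + Q c + emb2 (e a c)
      + emb2 (b (epsEl Ibar a) (epsEl Ibar c)) := by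
    intro a c
    obtain ⟨x, rfl⟩ := hpr a
    obtain ⟨y, rfl⟩ := hpr c
    have h4 : (4 : ZMod 4) = 0 := rfl
    rw [← map_add, hQ, hQ, hQ, hbpr, he, emb2_int, emb2_int]
    simp only [map_add, LinearMap.add_apply]
    rw [hSsymm y x]
    push_cast
    linear_combination -((S (I x) y : ℤ) : ZMod 4) * h4
  have hQI : ∀ a, Q (Ibar a) = Q a := by
    intro a
    obtain ⟨x, rfl⟩ := hpr a
    rw [hIbar, hQ, hQ, hSI]
  rw [← count_main g hcard b hbs hbnd hbodd]
  congr 1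
  have hmem : ∀ R ∈ QuadSet (fun x y => b x y),
      (fun a => Q a + R (epsEl Ibar a)) ∈ QuadSet (fun x y => e x y) ∩
        {q | ∀ x, q (Ibar x) = q x} := by
    intro R hR
    constructor
    · intro x y
      have h1 := hR (epsEl Ibar x) (epsEl Ibar y)
      simp only at h1
      simp only [hQadd, hepsadd, h1]
      linear_combination emb2_self (b (epsEl Ibar x) (epsEl Ibar y))
    · intro x
      simp only [hQI, hepsI]
  have hinv : ∀ R ∈ QuadSet (fun x y => b x y), Qmap (fun a => Q a + R (epsEl Ibar a)) = R := by
    intro R hR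
    funext u
    obtain ⟨a, rfl⟩ := hepssurj u
    rw [hQmap _ (hmem R hR)]
    ring
  refine Nat.card_congr
    { toFun := fun q => ⟨Qmap q.1, ?_, q.2.2.2⟩
      invFun := fun R => ⟨fun a => Q a + R.1 (epsEl Ibar a), (hmem R.1 R.2.1).1,
        (hmem R.1 R.2.1).2, by rw [hinv R.1 R.2.1]; exact R.2.2⟩
      left_inv := ?_
      right_inv := ?_ }
  · have h := hQmap q.1 ⟨q.2.1, q.2.2.1⟩
    intro u v
    obtain ⟨a, rfl⟩ := hepssurj u
    obtain ⟨c, rfl⟩ := hepssurj v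
    have h1 := q.2.1 a c
    simp only at h1
    rw [← hepsadd, h, h, h, h1, hQadd]
    linear_combination -emb2_self (b (epsEl Ibar a) (epsEl Ibar c))
  · intro q
    have h := hQmap q.1 ⟨q.2.1, q.2.2.1⟩
    apply Subtype.ext
    funext a
    simp only [h]
    ring
  · intro R
    apply Subtype.ext
    exact hinv R.1 R.2.1
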